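/- Let (V, ω) be a symplectic vector space of dimension 2n and T : V → V a linear map with T*(ω^k) = ω^k for some 1 ≤ k ≤ n. Then T*(ω^n) = λ ω^n with λ^k = 1; in particular if k is odd, T preserves the volume form ω^n. -/

import Mathlib

set_option synthInstance.maxHeartbeats 1000000
set_option maxHeartbeats 1000000

noncomputable section

open ExteriorAlgebra

/-- The value of an exterior 2-form on two vectors, obtained by contracting twice. -/
def formEval {V : Type*} [AddCommGroup V] [Module ℝ V]
    (x : ExteriorAlgebra ℝ (Module.Dual ℝ V)) (u v : V) : ℝ :=
  algebraMapInv
    (CliffordAlgebra.contractLeft (Module.Dual.eval ℝ V v)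
      (CliffordAlgebra.contractLeft (Module.Dual.eval ℝ V u) x))

/-- Pullback of forms by a linear map. -/
def pullback {V : Type*} [AddCommGroup V] [Module ℝ V] (T : V →ₗ[ℝ] V) :
    ExteriorAlgebra ℝ (Module.Dual ℝ V) →ₐ[ℝ] ExteriorAlgebra ℝ (Module.Dual ℝ V) :=
  ExteriorAlgebra.map T.dualMap

/-- Contraction of a form by a vector. -/
def ctr {V : Type*} [AddCommGroup V] [Module ℝ V] (u : V) :
    ExteriorAlgebra ℝ (Module.Dual ℝ V) →ₗ[ℝ] ExteriorAlgebra ℝ (Module.Dual ℝ V) :=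
  CliffordAlgebra.contractLeft (Q := (0 : QuadraticForm ℝ (Module.Dual ℝ V)))
    (Module.Dual.eval ℝ V u)

section helpers
variable {V : Type*} [AddCommGroup V] [Module ℝ V]

lemma ctr_ι_mul (u : V) (a : Module.Dual ℝ V) (x : ExteriorAlgebra ℝ (Module.Dual ℝ V)) :
    ctr u (ι ℝ a * x) = a u • x - ι ℝ a * ctr u x :=
  CliffordAlgebra.contractLeft_ι_mul (Q := (0 : QuadraticForm ℝ (Module.Dual ℝ V))) _ _ _

lemma ctr_ι (u : V) (a : Module.Dual ℝ V) :
    ctr u (ι ℝ a) = algebraMap ℝ _ (a u) :=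
  CliffordAlgebra.contractLeft_ι (Q := (0 : QuadraticForm ℝ (Module.Dual ℝ V))) _ _

lemma ctr_add_left (u v : V) (x : ExteriorAlgebra ℝ (Module.Dual ℝ V)) :
    ctr (u + v) x = ctr u x + ctr v x := by
  simp [ctr]

lemma ctr_smul_left (c : ℝ) (v : V) (x : ExteriorAlgebra ℝ (Module.Dual ℝ V)) :
    ctr (c • v) x = c • ctr v x := by
  simp [ctr]

lemma two_induction {P : ExteriorAlgebra ℝ (Module.Dual ℝ V) → Prop}
    {x : ExteriorAlgebra ℝ (Module.Dual ℝ V)} (hx : x ∈ ⋀[ℝ]^2 (Module.Dual ℝ V))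
    (h1 : ∀ a b : Module.Dual ℝ V, P (ι ℝ a * ι ℝ b))
    (h2 : ∀ x y, P x → P y → P (x + y)) : P x := by
  have hx' : x ∈ LinearMap.range (ι ℝ : Module.Dual ℝ V →ₗ[ℝ] _) *
      LinearMap.range (ι ℝ : Module.Dual ℝ V →ₗ[ℝ] _) := by
    rw [← pow_two]; exact hx
  refine Submodule.mul_induction_on hx' ?_ h2
  rintro _ ⟨a, rfl⟩ _ ⟨b, rfl⟩
  exact h1 a b

lemma ι_anti (a b : Module.Dual ℝ V) : ι ℝ a * ι ℝ b = - (ι ℝ b * ι ℝ a) :=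
  eq_neg_of_add_eq_zero_left (ι_add_mul_swap a b)

lemma two_comm {x : ExteriorAlgebra ℝ (Module.Dual ℝ V)} (hx : x ∈ ⋀[ℝ]^2 (Module.Dual ℝ V))
    (c : Module.Dual ℝ V) : x * ι ℝ c = ι ℝ c * x := by
  refine two_induction (P := fun x => x * ι ℝ c = ι ℝ c * x) hx ?_ ?_
  · intro a b
    rw [mul_assoc, ι_anti b c, mul_neg, ← mul_assoc, ι_anti a c, neg_mul, neg_neg, mul_assoc]
  · intro x y h1 h2
    rw [add_mul, mul_add, h1, h2]

lemma ctr_two_mul {x : ExteriorAlgebra ℝ (Module.Dual ℝ V)} (hx : x ∈ ⋀[ℝ]^2 (Module.Dual ℝ V))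
    (u : V) (y : ExteriorAlgebra ℝ (Module.Dual ℝ V)) :
    ctr u (x * y) = ctr u x * y + x * ctr u y := by
  refine two_induction (P := fun x => ctr u (x * y) = ctr u x * y + x * ctr u y) hx ?_ ?_
  · intro a b
    rw [mul_assoc, ctr_ι_mul, ctr_ι_mul, ctr_ι_mul, ctr_ι, Algebra.algebraMap_eq_smul_one]
    simp only [mul_sub, sub_mul, smul_mul_assoc, mul_smul_comm, mul_one, mul_assoc]
    abel
  · intro x y h1 h2
    rw [add_mul, map_add, h1, h2, map_add, add_mul, add_mul]; abel

lemma ctr_two_mem {x : ExteriorAlgebra ℝ (Module.Dual ℝ V)} (hx : x ∈ ⋀[ℝ]^2 (Module.Dual ℝ V))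
    (u : V) : ctr u x = ι ℝ (ιInv (ctr u x)) := by
  refine two_induction (P := fun x => ctr u x = ι ℝ (ιInv (ctr u x))) hx ?_ ?_
  · intro a b
    have : ctr u (ι ℝ a * ι ℝ b) = ι ℝ (a u • b - b u • a) := by
      rw [ctr_ι_mul, ctr_ι, Algebra.algebraMap_eq_smul_one]
      simp
    rw [this, ι_leftInverse (R := ℝ) (M := Module.Dual ℝ V)]
  · intro x y h1 h2
    rw [map_add, map_add, map_add, ← h1, ← h2]

/-- The map u ↦ i_u x for a 2-form x. -/
def flat (x : ExteriorAlgebra ℝ (Module.Dual ℝ V)) : V →ₗ[ℝ] Module.Dual ℝ V where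
  toFun u := ιInv (ctr u x)
  map_add' u v := by rw [ctr_add_left, map_add]
  map_smul' c v := by rw [ctr_smul_left, map_smul]; rfl

lemma ctr_two {x : ExteriorAlgebra ℝ (Module.Dual ℝ V)} (hx : x ∈ ⋀[ℝ]^2 (Module.Dual ℝ V))
    (u : V) : ctr u x = ι ℝ (flat x u) := ctr_two_mem hx u

lemma formEval_two {x : ExteriorAlgebra ℝ (Module.Dual ℝ V)}
    (hx : x ∈ ⋀[ℝ]^2 (Module.Dual ℝ V)) (u v : V) : formEval x u v = flat x u v := by
  change algebraMapInv (ctr v (ctr u x)) = _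
  rw [ctr_two hx, ctr_ι]
  exact algebraMap_leftInverse _ _

lemma pullback_two {x : ExteriorAlgebra ℝ (Module.Dual ℝ V)}
    (hx : x ∈ ⋀[ℝ]^2 (Module.Dual ℝ V)) (T : V →ₗ[ℝ] V) :
    pullback T x ∈ ⋀[ℝ]^2 (Module.Dual ℝ V) := by
  refine two_induction (P := fun x => pullback T x ∈ ⋀[ℝ]^2 (Module.Dual ℝ V)) hx ?_ ?_
  · intro a b
    rw [pullback, map_mul, map_apply_ι, map_apply_ι]
    change _ ∈ LinearMap.range (ι ℝ : Module.Dual ℝ V →ₗ[ℝ] _) ^ 2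
    rw [pow_two]
    exact Submodule.mul_mem_mul ⟨_, rfl⟩ ⟨_, rfl⟩
  · intro x y h1 h2
    rw [map_add]; exact Submodule.add_mem _ h1 h2

lemma euler {κ : Type*} [Fintype κ] [DecidableEq κ] (e : Module.Basis κ ℝ V)
    {x : ExteriorAlgebra ℝ (Module.Dual ℝ V)} (hx : x ∈ ⋀[ℝ]^2 (Module.Dual ℝ V)) :
    ∑ i, ι ℝ (e.coord i) * ctr (e i) x = (2 : ℝ) • x := by
  have key : ∀ a : Module.Dual ℝ V, ∑ i, a (e i) • ι ℝ (e.coord i) = ι ℝ a := by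
    intro a
    have h0 : a = ∑ i, a (e i) • e.coord i := by
      refine e.ext fun j => ?_
      simp [Finsupp.single_apply]
    conv_rhs => rw [h0, map_sum]
    simp only [map_smul]
  refine two_induction (P := fun x => ∑ i, ι ℝ (e.coord i) * ctr (e i) x = (2 : ℝ) • x) hx ?_ ?_
  · intro a b
    have : ∀ i, ι ℝ (e.coord i) * ctr (e i) (ι ℝ a * ι ℝ b) =
        (a (e i) • ι ℝ (e.coord i)) * ι ℝ b - (b (e i) • ι ℝ (e.coord i)) * ι ℝ a := by
      intro i
      rw [ctr_ι_mul, ctr_ι, Algebra.algebraMap_eq_smul_one]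
      simp [mul_sub]
    rw [Finset.sum_congr rfl fun i _ => this i, Finset.sum_sub_distrib, ← Finset.sum_mul,
      ← Finset.sum_mul, key, key, ι_anti b a, two_smul, sub_neg_eq_add]
  · intro x y h1 h2
    simp only [map_add, mul_add, Finset.sum_add_distrib, h1, h2, smul_add]

lemma lef {ω : ExteriorAlgebra ℝ (Module.Dual ℝ V)} (hω : ω ∈ ⋀[ℝ]^2 (Module.Dual ℝ V))
    (v : V) (j : ℕ) (x : ExteriorAlgebra ℝ (Module.Dual ℝ V)) :
    ω * ctr v (ω ^ j * x) = (j : ℝ) • (ι ℝ (flat ω v) * (ω ^ j * x)) + ω ^ (j + 1) * ctr v x := by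
  induction j with
  | zero => simp
  | succ j ih =>
    rw [pow_succ' ω j, mul_assoc, ctr_two_mul hω, mul_add, ih, ctr_two hω, mul_add,
      mul_smul_comm, ← mul_assoc ω (ι ℝ _), two_comm hω, pow_succ' ω (j+1)]
    push_cast
    rw [add_smul, one_smul]
    simp only [mul_assoc]
    abel

lemma lef_zero {ω : ExteriorAlgebra ℝ (Module.Dual ℝ V)} (hω : ω ∈ ⋀[ℝ]^2 (Module.Dual ℝ V))
    (v : V) (j : ℕ) (x : ExteriorAlgebra ℝ (Module.Dual ℝ V)) (h : ω ^ j * x = 0) :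
    ω ^ (j + 1) * ctr v x = 0 := by
  have := lef hω v j x
  rw [h] at this
  simpa using this.symm

lemma ctr_pow {ω : ExteriorAlgebra ℝ (Module.Dual ℝ V)} (hω : ω ∈ ⋀[ℝ]^2 (Module.Dual ℝ V))
    (v : V) (j : ℕ) :
    ctr v (ω ^ (j + 1)) = ((j : ℝ) + 1) • (ι ℝ (flat ω v) * ω ^ j) := by
  have h1 : ctr v (1 : ExteriorAlgebra ℝ (Module.Dual ℝ V)) = 0 :=
    CliffordAlgebra.contractLeft_one (0 : QuadraticForm ℝ (Module.Dual ℝ V)) _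
  have := lef hω v j 1
  rw [h1, mul_one, mul_zero, add_zero] at this
  rw [pow_succ', ctr_two_mul hω, this, ctr_two hω, add_smul, one_smul, add_comm]

lemma pow_ne [FiniteDimensional ℝ V] {ω : ExteriorAlgebra ℝ (Module.Dual ℝ V)}
    (hω : ω ∈ ⋀[ℝ]^2 (Module.Dual ℝ V)) (n : ℕ) (hdim : Module.finrank ℝ V = 2 * n)
    (hs : Function.Surjective (flat ω)) (m : ℕ) (hm : m ≤ n) : ω ^ m ≠ 0 := by
  induction m with
  | zero => simp
  | succ m ih =>
    intro h
    apply ih (by omega)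
    have hk : ∀ a, ι ℝ a * ω ^ m = 0 := by
      intro a
      obtain ⟨v, rfl⟩ := hs a
      have h2 := ctr_pow hω v m
      rw [h, map_zero] at h2
      exact (smul_eq_zero.1 h2.symm).resolve_left (by positivity)
    let e := Module.finBasis ℝ V
    have h3 : ∀ i, ι ℝ (e.coord i) * ctr (e i) (ω ^ m) = ω ^ m := by
      intro i
      have h4 := ctr_ι_mul (e i) (e.coord i) (ω ^ m)
      rw [hk, map_zero] at h4
      have h5 : e.coord i (e i) = 1 := by simp
      rw [h5, one_smul] at h4
      exact (sub_eq_zero.1 h4.symm).symm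
    have h6 : ∑ i, ι ℝ (e.coord i) * ctr (e i) (ω ^ m) = (2 * n : ℝ) • ω ^ m := by
      rw [Finset.sum_congr rfl fun i _ => h3 i]
      simp [hdim, ← Nat.cast_smul_eq_nsmul ℝ]
    have h7 : ∑ i, ι ℝ (e.coord i) * ctr (e i) (ω ^ m) = (2 * m : ℝ) • ω ^ m := by
      rcases m with _ | m
      · have h1 : ∀ v : V, ctr v (1 : ExteriorAlgebra ℝ (Module.Dual ℝ V)) = 0 :=
          fun v => CliffordAlgebra.contractLeft_one (0 : QuadraticForm ℝ (Module.Dual ℝ V)) _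
        simp [h1]
      · have : ∀ i, ι ℝ (e.coord i) * ctr (e i) (ω ^ (m + 1)) =
            ((m : ℝ) + 1) • ((ι ℝ (e.coord i) * ctr (e i) ω) * ω ^ m) := by
          intro i
          rw [ctr_pow hω, ctr_two hω, mul_smul_comm, mul_assoc]
        rw [Finset.sum_congr rfl fun i _ => this i, ← Finset.smul_sum, ← Finset.sum_mul,
          euler e hω, smul_mul_assoc, smul_smul, ← pow_succ']
        push_cast
        ring_nf
    have h8 : (2 * n - 2 * m : ℝ) • ω ^ m = 0 := by
      rw [sub_smul, ← h6, ← h7, sub_self]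
    refine (smul_eq_zero.1 h8).resolve_left ?_
    have : (m : ℝ) + 1 ≤ n := by exact_mod_cast hm
    intro h9
    linarith

lemma key_scalar [FiniteDimensional ℝ V] {ω σ : ExteriorAlgebra ℝ (Module.Dual ℝ V)}
    (hω : ω ∈ ⋀[ℝ]^2 (Module.Dual ℝ V)) (hσ : σ ∈ ⋀[ℝ]^2 (Module.Dual ℝ V))
    (n k : ℕ) (hdim : Module.finrank ℝ V = 2 * n)
    (hs : Function.Surjective (flat ω)) (hk : k + 1 < n)
    (h : σ ^ (k + 1) = ω ^ (k + 1)) (u v w : V) :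
    flat ω u v * flat σ u w = flat σ u v * flat ω u w := by
  have h1 : ι ℝ (flat σ u) * σ ^ k = ι ℝ (flat ω u) * ω ^ k := by
    have h2 := ctr_pow hω u k
    rw [← h, ctr_pow hσ u k] at h2
    exact smul_right_injective _ (by positivity : (k : ℝ) + 1 ≠ 0) h2
  have hc : ∀ (c : Module.Dual ℝ V) j, ω ^ j * ι ℝ c = ι ℝ c * ω ^ j := fun c j =>
    ((show Commute ω (ι ℝ c) from two_comm hω c).pow_left j)
  have h3 : ω ^ k * (ι ℝ (flat σ u) * ι ℝ (flat ω u)) = 0 := by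
    rw [← mul_assoc, hc, mul_assoc, hc, ← h1, ← mul_assoc, ι_sq_zero, zero_mul]
  have h5 := lef_zero hω w _ _ (lef_zero hω v _ _ h3)
  have h6 : ctr w (ctr v (ι ℝ (flat σ u) * ι ℝ (flat ω u))) =
      algebraMap ℝ _ (flat σ u v * flat ω u w - flat ω u v * flat σ u w) := by
    rw [ctr_ι_mul, ctr_ι, Algebra.algebraMap_eq_smul_one, mul_smul_comm, mul_one, map_sub,
      map_smul, map_smul, ctr_ι, ctr_ι]
    simp [Algebra.algebraMap_eq_smul_one, sub_smul, smul_smul]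
  rw [h6, Algebra.algebraMap_eq_smul_one, mul_smul_comm, mul_one] at h5
  have := (smul_eq_zero.1 h5).resolve_right (pow_ne hω n hdim hs _ (by omega))
  linarith

end helpers

theorem stmt17 {V : Type*} [AddCommGroup V] [Module ℝ V] [FiniteDimensional ℝ V]
    (n k : ℕ) (hdim : Module.finrank ℝ V = 2 * n) (hk1 : 1 ≤ k) (hkn : k ≤ n)
    (ω : ExteriorAlgebra ℝ (Module.Dual ℝ V))
    (hω2 : ω ∈ ⋀[ℝ]^2 (Module.Dual ℝ V))
    (hnd : ∀ u : V, (∀ v : V, formEval ω u v = 0) → u = 0)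
    (T : V →ₗ[ℝ] V)
    (hT : pullback T (ω ^ k) = ω ^ k) :
    ∃ lam : ℝ, pullback T (ω ^ n) = lam • ω ^ n ∧ lam ^ k = 1 ∧
      (Odd k → pullback T (ω ^ n) = ω ^ n) := by
  have hinj : Function.Injective (flat ω) := by
    rw [← LinearMap.ker_eq_bot, LinearMap.ker_eq_bot']
    intro u hu
    exact hnd u fun v => by rw [formEval_two hω2, hu]; rfl
  have hfin : Module.finrank ℝ V = Module.finrank ℝ (Module.Dual ℝ V) :=
    Subspace.dual_finrank_eq.symm
  have hs : Function.Surjective (flat ω) :=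
    (LinearMap.injective_iff_surjective_of_finrank_eq_finrank hfin).1 hinj
  rcases hkn.eq_or_lt with rfl | hlt
  · exact ⟨1, by rw [hT, one_smul], one_pow _, fun _ => hT⟩
  obtain ⟨k, rfl⟩ : ∃ j, k = j + 1 := ⟨k - 1, by omega⟩
  have hσ := pullback_two hω2 T
  set σ := pullback T ω with hσdef
  have hpow : ∀ j, pullback T (ω ^ j) = σ ^ j := fun j => map_pow _ _ _
  rw [hpow] at hT
  have key := key_scalar hω2 hσ n k hdim hs hlt hT
  let E : V ≃ₗ[ℝ] Module.Dual ℝ V := LinearEquiv.ofBijective (flat ω) ⟨hinj, hs⟩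
  let A : V →ₗ[ℝ] V := E.symm.toLinearMap ∘ₗ flat σ
  have hA : ∀ u, flat ω (A u) = flat σ u := fun u => E.apply_symm_apply (flat σ u)
  have hA2 : ∀ u, ∃ c : ℝ, A u = c • u := by
    intro u
    by_cases hu : u = 0
    · exact ⟨0, by simp [hu]⟩
    obtain ⟨v, hv⟩ : ∃ v, flat ω u v ≠ 0 := by
      by_contra! hcon
      exact hu (hnd u fun v => by rw [formEval_two hω2, hcon])
    refine ⟨flat σ u v / flat ω u v, hinj ?_⟩
    rw [hA, map_smul]
    ext w
    have := key u v w
    simp only [LinearMap.smul_apply, smul_eq_mul]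
    field_simp
    linarith
  obtain ⟨c, hc⟩ : ∃ c : ℝ, ∀ u, A u = c • u := by
    obtain ⟨c, hc⟩ := A.exists_eq_smul_id_of_forall_notLinearIndependent (by
      intro u hli
      obtain ⟨c, hc⟩ := hA2 u
      rw [hc] at hli
      have := LinearIndependent.pair_iff.1 hli c (-1) (by simp)
      norm_num at this)
    exact ⟨c, fun u => by rw [hc]; rfl⟩
  have hσω : σ = c • ω := by
    let e := Module.finBasis ℝ V
    have h1 := euler e hσ
    have h2 := euler e hω2
    have h3 : ∀ u, ctr u σ = c • ctr u ω := by
      intro u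
      rw [ctr_two hσ, ctr_two hω2, ← hA, hc, map_smul, map_smul]
    simp only [h3, mul_smul_comm] at h1
    rw [← Finset.smul_sum, h2, smul_comm] at h1
    exact (smul_right_injective _ (two_ne_zero (α := ℝ)) h1).symm
  have hck : c ^ (k + 1) = 1 := by
    rw [hσω, smul_pow] at hT
    have h1 : (c ^ (k + 1) - 1) • ω ^ (k + 1) = 0 := by rw [sub_smul, hT, one_smul, sub_self]
    have := (smul_eq_zero.1 h1).resolve_right (pow_ne hω2 n hdim hs _ hkn)
    linarith
  refine ⟨c ^ n, by rw [hpow, hσω, smul_pow], by rw [← pow_mul, mul_comm, pow_mul, hck, one_pow], ?_⟩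
  intro hodd
  have hc1 : c = 1 := hodd.strictMono_pow.injective (by simpa using hck)
  rw [hpow, hσω, hc1, one_smul]
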